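/- arXiv:2412.17962 — 2 statements merged into one kernel-verified Lean document; each statement's English description precedes it below -/
import Mathlib

section
/- Let G be a nontrivial uniquely C4+-saturated graph, let S = {v1, v2, v3} be the vertex set of a triangle in G, and let Vi = N(vi) \ S for i = 1, 2, 3. Then: (i) every vertex of G is in S, at distance 1 from S, or at distance 2 from S; (ii) Vi ∩ Vj = ∅ for i ≠ j; (iii) N(S) = V1 ∪ V2 ∪ V3 is an independent set in G; (iv) every vertex at distance 2 from S has exactly one or exactly two neighbors in each Vi. -/
open SimpleGraph

/-- The diamond graph `C₄⁺`: a `4`-cycle with one chord, i.e. `K₄` minus an edge. -/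
def diamond : SimpleGraph (Fin 4) := (⊤ : SimpleGraph (Fin 4)).deleteEdges {s(0, 1)}

/-- `G'` is a copy of `H` in `G`, i.e. a subgraph of `G` isomorphic to `H`. -/
def IsCopy {W V : Type*} (H : SimpleGraph W) {G : SimpleGraph V} (G' : G.Subgraph) : Prop :=
  Nonempty (G'.coe ≃g H)

/-- `G` is uniquely `H`-saturated: `G` is `H`-free, and adding any non-edge
creates exactly one copy of `H`. -/
def UniquelySaturated {W V : Type*} (H : SimpleGraph W) (G : SimpleGraph V) : Prop :=
  (∀ G' : G.Subgraph, ¬ IsCopy H G') ∧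
    ∀ u v : V, u ≠ v → ¬ G.Adj u v →
      ∃! G' : (G ⊔ SimpleGraph.fromEdgeSet {s(u, v)}).Subgraph, IsCopy H G'


/-- `a,b,c,d` span a (not necessarily induced) diamond with centre edge `cd`. -/
def Dia {V : Type*} (G : SimpleGraph V) (a b c d : V) : Prop :=
  a ≠ b ∧ G.Adj c d ∧ G.Adj a c ∧ G.Adj a d ∧ G.Adj b c ∧ G.Adj b d

theorem Dia.exists_copy {V : Type*} {G : SimpleGraph V} {a b c d : V} (h : Dia G a b c d) :
    ∃ G' : G.Subgraph, IsCopy diamond G' ∧ G'.verts = {a, b, c, d} := by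
  obtain ⟨hab, hcd, hac, had, hbc, hbd⟩ := h
  let f : diamond →g G :=
    { toFun := ![a, b, c, d]
      map_rel' := by
        intro x y hxy
        fin_cases x <;> fin_cases y <;> simp [diamond] at hxy ⊢ <;>
          first | assumption | (apply SimpleGraph.Adj.symm; assumption) }
  have hinj : Function.Injective f := by
    have := hcd.ne
    have := hac.ne
    have := had.ne
    have := hbc.ne
    have := hbd.ne
    intro x y hxy
    change ![a, b, c, d] x = ![a, b, c, d] y at hxy
    fin_cases x <;> fin_cases y <;> simp at hxy ⊢ <;> grind
  refine ⟨(f.toCopy hinj).toSubgraph, ⟨(f.toCopy hinj).isoToSubgraph.symm⟩, ?_⟩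
  ext x
  have : x ∈ (f.toCopy hinj).toSubgraph.verts ↔ ∃ i, ![a, b, c, d] i = x := by
    simp [Copy.toSubgraph]
    rfl
  rw [this]
  simp [Fin.exists_fin_succ, eq_comm]

theorem IsCopy.exists_dia {V : Type*} {G : SimpleGraph V} {G' : G.Subgraph}
    (h : IsCopy diamond G') : ∃ a b c d, Dia G a b c d := by
  obtain ⟨e⟩ := h
  have key : ∀ i j, diamond.Adj i j → G.Adj (e.symm i : V) (e.symm j : V) := fun i j hij =>
    G'.adj_sub ((e.symm.map_rel_iff).2 hij)
  refine ⟨e.symm 0, e.symm 1, e.symm 2, e.symm 3, ?_, ?_, ?_, ?_, ?_, ?_⟩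
  · intro h
    have := e.symm.injective (Subtype.ext h)
    simp at this
  all_goals apply key; simp [diamond]

theorem no_dia {V : Type*} {G : SimpleGraph V} (hsat : UniquelySaturated diamond G)
    {a b c d : V} (h : Dia G a b c d) : False := by
  obtain ⟨G', h1, -⟩ := h.exists_copy
  exact hsat.1 G' h1

theorem dia_unique {V : Type*} {G : SimpleGraph V} (hsat : UniquelySaturated diamond G)
    {u v : V} (huv : u ≠ v) (hn : ¬ G.Adj u v) {a b c d a' b' c' d' : V}
    (h : Dia (G ⊔ SimpleGraph.fromEdgeSet {s(u, v)}) a b c d)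
    (h' : Dia (G ⊔ SimpleGraph.fromEdgeSet {s(u, v)}) a' b' c' d') :
    ({a, b, c, d} : Set V) = {a', b', c', d'} := by
  obtain ⟨A, hA, hAv⟩ := h.exists_copy
  obtain ⟨B, hB, hBv⟩ := h'.exists_copy
  rw [← hAv, ← hBv, (hsat.2 u v huv hn).unique hA hB]

theorem adj_add {V : Type*} {G : SimpleGraph V} {u v x y : V} :
    (G ⊔ SimpleGraph.fromEdgeSet {s(u, v)}).Adj x y ↔
      G.Adj x y ∨ (((x = u ∧ y = v) ∨ (x = v ∧ y = u)) ∧ x ≠ y) := by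
  simp

theorem exists_common {V : Type*} {G : SimpleGraph V} (hsat : UniquelySaturated diamond G)
    {u v : V} (huv : u ≠ v) (hn : ¬ G.Adj u v) : ∃ w, G.Adj u w ∧ G.Adj v w := by
  obtain ⟨G', hG', -⟩ := hsat.2 u v huv hn
  obtain ⟨a, b, c, d, hab, hcd, hac, had, hbc, hbd⟩ := hG'.exists_dia
  have hno : ¬ Dia G a b c d := no_dia hsat
  have hs : ∀ x y, G.Adj x y → G.Adj y x := fun _ _ h => h.symm
  have h1 := hcd.ne
  have h2 := hac.ne
  have h3 := had.ne
  have h4 := hbc.ne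
  have h5 := hbd.ne
  rw [adj_add] at hcd hac had hbc hbd
  unfold Dia at hno
  by_contra! hw
  have hw' : ∀ w, G.Adj u w → ¬ G.Adj v w := hw
  grind

/-- No bowtie and independence inside one part. -/
theorem indep_same {V : Type*} {G : SimpleGraph V} (hsat : UniquelySaturated diamond G)
    {p q r x y : V} (hpq : G.Adj p q) (hpr : G.Adj p r) (hqr : G.Adj q r)
    (hxp : G.Adj x p) (hyp : G.Adj y p) (hxy : G.Adj x y)
    (hxq : x ≠ q) (hxr : x ≠ r) (hyq : y ≠ q) (hyr : y ≠ r) : False := by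
  have hn : ¬ G.Adj x q := fun h => no_dia hsat (a := x) (b := r) (c := p) (d := q)
    ⟨hxr, hpq, hxp, h, hpr.symm, hqr.symm⟩
  have e := dia_unique hsat hxq hn (a := q) (b := y) (c := x) (d := p)
    (a' := x) (b' := r) (c' := q) (d' := p)
    (by refine ⟨hyq.symm, ?_⟩; simp only [adj_add]; simp [hxp, hxy.symm, hyp, hpq.symm, hxq.symm])
    (by refine ⟨hxr, ?_⟩; simp only [adj_add]; simp [hxp, hqr.symm, hpr.symm, hpq.symm, hxq])
  have : y ∈ ({x, r, q, p} : Set V) := by rw [← e]; simp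
  have := hxy.ne
  have := hyp.ne
  simp at *
  grind

theorem indep_diff {V : Type*} {G : SimpleGraph V} (hsat : UniquelySaturated diamond G)
    {p q r x y : V} (hpq : G.Adj p q) (hpr : G.Adj p r) (hqr : G.Adj q r)
    (hxp : G.Adj x p) (hyq : G.Adj y q) (hxy : G.Adj x y)
    (hxq : x ≠ q) (hxr : x ≠ r) (hyp : y ≠ p) (hyr : y ≠ r) : False := by
  have hn : ¬ G.Adj x q := fun h => no_dia hsat (a := x) (b := r) (c := p) (d := q)
    ⟨hxr, hpq, hxp, h, hpr.symm, hqr.symm⟩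
  have e := dia_unique hsat hxq hn (a := p) (b := y) (c := x) (d := q)
    (a' := x) (b' := r) (c' := q) (d' := p)
    (by refine ⟨hyp.symm, ?_⟩; simp only [adj_add]; simp [hxp.symm, hxy.symm, hyq, hpq, hxq])
    (by refine ⟨hxr, ?_⟩; simp only [adj_add]; simp [hxp, hqr.symm, hpr.symm, hpq.symm, hxq])
  have : y ∈ ({x, r, q, p} : Set V) := by rw [← e]; simp
  have := hxy.ne
  have := hyq.ne
  simp at *
  grind

theorem card_common {V : Type*} [Fintype V] {G : SimpleGraph V}
    (hsat : UniquelySaturated diamond G)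
    {p q r v : V} (hvp : v ≠ p)
    (np : ¬ G.Adj v p) (nq : ¬ G.Adj v q) (nr : ¬ G.Adj v r) {S : Set V}
    (hS : ∀ x, x ∈ S ↔ x = p ∨ x = q ∨ x = r) :
    (G.neighborSet v ∩ (G.neighborSet p \ S)).ncard = 1 ∨
      (G.neighborSet v ∩ (G.neighborSet p \ S)).ncard = 2 := by
  set T := G.neighborSet v ∩ (G.neighborSet p \ S) with hT
  have h1 : 0 < T.ncard := by
    rw [Set.ncard_pos]
    obtain ⟨w, hw1, hw2⟩ := exists_common hsat hvp np
    refine ⟨w, hw1, hw2, ?_⟩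
    rw [hS]
    rintro (rfl | rfl | rfl) <;> contradiction
  have h2 : ¬ 2 < T.ncard := by
    rw [Set.two_lt_ncard_iff]
    rintro ⟨a, b, c, ha, hb, hc, hab, hac, hbc⟩
    have a1 : G.Adj v a := ha.1
    have b1 : G.Adj v b := hb.1
    have c1 : G.Adj v c := hc.1
    have a2 : G.Adj p a := ha.2.1
    have b2 : G.Adj p b := hb.2.1
    have c2 : G.Adj p c := hc.2.1
    have e := dia_unique hsat hvp np (a := a) (b := b) (c := v) (d := p)
      (a' := a) (b' := c) (c' := v) (d' := p)
      (by refine ⟨hab, ?_⟩; simp only [adj_add]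
          simp [a1.symm, b1.symm, a2.symm, b2.symm, hvp])
      (by refine ⟨hac, ?_⟩; simp only [adj_add]
          simp [a1.symm, c1.symm, a2.symm, c2.symm, hvp])
    have hb' : b ∈ ({a, c, v, p} : Set V) := by rw [← e]; simp
    have := b1.ne
    have := b2.ne
    simp at hb'
    grind
  omega

theorem stmt5 {V : Type*} [Fintype V] (G : SimpleGraph V)
    (hcard : 4 ≤ Fintype.card V) (hsat : UniquelySaturated diamond G)
    (v1 v2 v3 : V) (h12 : G.Adj v1 v2) (h13 : G.Adj v1 v3) (h23 : G.Adj v2 v3) :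
    -- (i) every vertex is in `S`, at distance 1 from `S`, or at distance 2 from `S`
    (∀ v : V, min (G.dist v v1) (min (G.dist v v2) (G.dist v v3)) ≤ 2) ∧
    -- (ii) the sets `Vᵢ` are pairwise disjoint
    ((G.neighborSet v1 \ {v1, v2, v3}) ∩ (G.neighborSet v2 \ {v1, v2, v3}) = ∅ ∧
      (G.neighborSet v1 \ {v1, v2, v3}) ∩ (G.neighborSet v3 \ {v1, v2, v3}) = ∅ ∧
      (G.neighborSet v2 \ {v1, v2, v3}) ∩ (G.neighborSet v3 \ {v1, v2, v3}) = ∅) ∧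
    -- (iii) `N(S) = V₁ ∪ V₂ ∪ V₃` and it is an independent set
    ({v : V | v ∉ ({v1, v2, v3} : Set V) ∧ (G.Adj v v1 ∨ G.Adj v v2 ∨ G.Adj v v3)} =
        (G.neighborSet v1 \ {v1, v2, v3}) ∪ (G.neighborSet v2 \ {v1, v2, v3}) ∪
          (G.neighborSet v3 \ {v1, v2, v3}) ∧
      ∀ x ∈ {v : V | v ∉ ({v1, v2, v3} : Set V) ∧ (G.Adj v v1 ∨ G.Adj v v2 ∨ G.Adj v v3)},
        ∀ y ∈ {v : V | v ∉ ({v1, v2, v3} : Set V) ∧ (G.Adj v v1 ∨ G.Adj v v2 ∨ G.Adj v v3)},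
          ¬ G.Adj x y) ∧
    -- (iv) every vertex at distance 2 from `S` has one or two neighbors in each `Vᵢ`
    (∀ v : V, min (G.dist v v1) (min (G.dist v v2) (G.dist v v3)) = 2 →
      ((G.neighborSet v ∩ (G.neighborSet v1 \ {v1, v2, v3})).ncard = 1 ∨
        (G.neighborSet v ∩ (G.neighborSet v1 \ {v1, v2, v3})).ncard = 2) ∧
      ((G.neighborSet v ∩ (G.neighborSet v2 \ {v1, v2, v3})).ncard = 1 ∨
        (G.neighborSet v ∩ (G.neighborSet v2 \ {v1, v2, v3})).ncard = 2) ∧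
      ((G.neighborSet v ∩ (G.neighborSet v3 \ {v1, v2, v3})).ncard = 1 ∨
        (G.neighborSet v ∩ (G.neighborSet v3 \ {v1, v2, v3})).ncard = 2)) := by
  have far : ∀ v w, 2 ≤ G.dist v w → v ≠ w ∧ ¬ G.Adj v w := by
    intro v w h
    refine ⟨?_, ?_⟩
    · rintro rfl
      simp at h
    · intro h'
      rw [SimpleGraph.dist_eq_one_iff_adj.2 h'] at h
      omega
  have dis : ∀ p q r x : V, G.Adj p q → G.Adj p r → G.Adj q r → x ≠ r →
      G.Adj p x → G.Adj q x → False := fun p q r x hpq hpr hqr hx h1 h2 =>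
    no_dia hsat (a := x) (b := r) (c := p) (d := q)
      ⟨hx, hpq, h1.symm, h2.symm, hpr.symm, hqr.symm⟩
  refine ⟨?_, ⟨?_, ?_, ?_⟩, ⟨?_, ?_⟩, ?_⟩
  · intro v
    by_contra! hlt
    have hd : 2 < G.dist v v1 := by
      omega
    obtain ⟨hne, hna⟩ := far v v1 hd.le
    obtain ⟨w, hw1, hw2⟩ := exists_common hsat hne hna
    have := SimpleGraph.dist_le (Walk.cons hw1 (Walk.cons hw2.symm Walk.nil))
    simp at this
    omega
  · ext x
    simp only [Set.mem_inter_iff, Set.mem_sdiff, mem_neighborSet, Set.mem_insert_iff,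
      Set.mem_singleton_iff, Set.mem_empty_iff_false, iff_false]
    rintro ⟨⟨h1, hx⟩, h2, -⟩
    exact dis v1 v2 v3 x h12 h13 h23 (by tauto) h1 h2
  · ext x
    simp only [Set.mem_inter_iff, Set.mem_sdiff, mem_neighborSet, Set.mem_insert_iff,
      Set.mem_singleton_iff, Set.mem_empty_iff_false, iff_false]
    rintro ⟨⟨h1, hx⟩, h2, -⟩
    exact dis v1 v3 v2 x h13 h12 h23.symm (by tauto) h1 h2
  · ext x
    simp only [Set.mem_inter_iff, Set.mem_sdiff, mem_neighborSet, Set.mem_insert_iff,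
      Set.mem_singleton_iff, Set.mem_empty_iff_false, iff_false]
    rintro ⟨⟨h1, hx⟩, h2, -⟩
    exact dis v2 v3 v1 x h23 h12.symm h13.symm (by tauto) h1 h2
  · ext x
    simp only [Set.mem_ofPred_eq, Set.mem_union, Set.mem_sdiff, mem_neighborSet, G.adj_comm x]
    tauto
  · rintro x ⟨hx, hx'⟩ y ⟨hy, hy'⟩ hxy
    simp only [Set.mem_insert_iff, Set.mem_singleton_iff, not_or] at hx hy
    obtain ⟨x1, x2, x3⟩ := hx
    obtain ⟨y1, y2, y3⟩ := hy
    rcases hx' with hx' | hx' | hx' <;> rcases hy' with hy' | hy' | hy'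
    · exact indep_same hsat h12 h13 h23 hx' hy' hxy x2 x3 y2 y3
    · exact indep_diff hsat h12 h13 h23 hx' hy' hxy x2 x3 y1 y3
    · exact indep_diff hsat h13 h12 h23.symm hx' hy' hxy x3 x2 y1 y2
    · exact indep_diff hsat h12.symm h23 h13 hx' hy' hxy x1 x3 y2 y3
    · exact indep_same hsat h12.symm h23 h13 hx' hy' hxy x1 x3 y1 y3
    · exact indep_diff hsat h23 h12.symm h13.symm hx' hy' hxy x3 x1 y2 y1
    · exact indep_diff hsat h13.symm h23.symm h12 hx' hy' hxy x1 x2 y3 y2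
    · exact indep_diff hsat h23.symm h13.symm h12.symm hx' hy' hxy x2 x1 y3 y1
    · exact indep_same hsat h13.symm h23.symm h12 hx' hy' hxy x1 x2 y1 y2
  · intro v hv
    obtain ⟨n1, a1⟩ := far v v1 (by omega)
    obtain ⟨n2, a2⟩ := far v v2 (by omega)
    obtain ⟨n3, a3⟩ := far v v3 (by omega)
    refine ⟨card_common hsat n1 a1 a2 a3 ?_, card_common hsat n2 a2 a1 a3 ?_,
      card_common hsat n3 a3 a1 a2 ?_⟩ <;>
    · intro x
      simp only [Set.mem_insert_iff, Set.mem_singleton_iff]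
      try tauto
end

section
/- There is no uniquely C4+-saturated graph containing exactly two triangles. -/
open SimpleGraph

/-- The data extracted from a copy of the diamond. -/
lemma copy_data {V : Type*} {G : SimpleGraph V} (G' : G.Subgraph) (h : IsCopy diamond G') :
    ∃ a b c d : V, a ≠ b ∧ G.Adj a c ∧ G.Adj a d ∧ G.Adj b c ∧ G.Adj b d ∧ G.Adj c d := by
  obtain ⟨e⟩ := h
  have key : ∀ i j : Fin 4, diamond.Adj i j → G.Adj (e.symm i : V) (e.symm j : V) := by
    intro i j hij
    exact G'.adj_sub (e.symm.map_rel_iff.2 hij)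
  refine ⟨e.symm 0, e.symm 1, e.symm 2, e.symm 3, ?_, key _ _ ?_, key _ _ ?_, key _ _ ?_,
    key _ _ ?_, key _ _ ?_⟩
  · intro h
    have := e.symm.injective (Subtype.ext h)
    exact absurd this (by decide)
  all_goals simp [diamond]

lemma data_copy {V : Type*} {G : SimpleGraph V} {a b c d : V} (hab : a ≠ b)
    (hac : G.Adj a c) (had : G.Adj a d) (hbc : G.Adj b c) (hbd : G.Adj b d) (hcd : G.Adj c d) :
    ∃ G' : G.Subgraph, IsCopy diamond G' ∧ G'.verts = {a, b, c, d} := by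
  have h1 := hac.ne
  have h2 := had.ne
  have h3 := hbc.ne
  have h4 := hbd.ne
  have h5 := hcd.ne
  let f : Fin 4 → V := ![a, b, c, d]
  have hf : Function.Injective f := by
    intro i j hij
    fin_cases i <;> fin_cases j <;> simp [f] at hij ⊢ <;> grind
  have hom : ∀ {i j : Fin 4}, diamond.Adj i j → G.Adj (f i) (f j) := by
    intro i j hij
    fin_cases i <;> fin_cases j <;> simp [f, diamond] at hij ⊢ <;>
      first | assumption | (apply SimpleGraph.Adj.symm; assumption)
  let φ : Copy diamond G := ⟨⟨f, hom⟩, hf⟩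
  refine ⟨φ.toSubgraph, ⟨φ.isoToSubgraph.symm⟩, ?_⟩
  ext x
  simp [Copy.toSubgraph, φ, f, Fin.exists_fin_succ]
  grind

def TE {V : Type*} (G : SimpleGraph V) (u v : V) : Prop :=
  G.Adj u v ∧ ∃ w, G.Adj u w ∧ G.Adj v w

structure Good {V : Type*} (G : SimpleGraph V) : Prop where
  df : ∀ a b c d : V, a ≠ b → G.Adj a c → G.Adj a d → G.Adj b c → G.Adj b d → ¬ G.Adj c d
  ex : ∀ u v : V, u ≠ v → ¬ G.Adj u v →
    (∃ w w', w ≠ w' ∧ G.Adj u w ∧ G.Adj v w ∧ G.Adj u w' ∧ G.Adj v w') ∨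
    (∃ w, G.Adj u w ∧ G.Adj v w ∧ (TE G u w ∨ TE G v w))
  three : ∀ u v : V, u ≠ v → ¬ G.Adj u v → ∀ a b c, G.Adj u a → G.Adj v a → G.Adj u b → G.Adj v b →
    G.Adj u c → G.Adj v c → a ≠ b → c = a ∨ c = b
  te1 : ∀ u v : V, u ≠ v → ¬ G.Adj u v → ∀ w w', G.Adj u w → G.Adj v w → TE G u w →
    G.Adj u w' → G.Adj v w' → w' = w
  te2 : ∀ u v : V, u ≠ v → ¬ G.Adj u v → ∀ w, G.Adj u w → G.Adj v w → TE G u w → ¬ TE G v w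

lemma good_of {V : Type*} {G : SimpleGraph V} (h : UniquelySaturated diamond G) : Good G := by
  obtain ⟨hfree, hsat⟩ := h
  have df : ∀ a b c d : V, a ≠ b → G.Adj a c → G.Adj a d → G.Adj b c → G.Adj b d →
      ¬ G.Adj c d := by
    intro a b c d h1 h2 h3 h4 h5 h6
    obtain ⟨G', h, -⟩ := data_copy h1 h2 h3 h4 h5 h6
    exact hfree G' h
  have adj : ∀ u v : V, u ≠ v → ∀ x y, (G ⊔ SimpleGraph.fromEdgeSet {s(u, v)}).Adj x y ↔
      (G.Adj x y ∨ (x = u ∧ y = v) ∨ (x = v ∧ y = u)) := by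
    intro u v huv x y
    simp only [sup_adj, fromEdgeSet_adj, Set.mem_singleton_iff, Sym2.eq_iff]
    grind
  -- uniqueness of the vertex set
  have uq : ∀ u v : V, u ≠ v → ¬ G.Adj u v → ∀ a b c d a' b' c' d' : V,
      a ≠ b → a' ≠ b' →
      (G ⊔ SimpleGraph.fromEdgeSet {s(u, v)}).Adj a c →
      (G ⊔ SimpleGraph.fromEdgeSet {s(u, v)}).Adj a d →
      (G ⊔ SimpleGraph.fromEdgeSet {s(u, v)}).Adj b c →
      (G ⊔ SimpleGraph.fromEdgeSet {s(u, v)}).Adj b d →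
      (G ⊔ SimpleGraph.fromEdgeSet {s(u, v)}).Adj c d →
      (G ⊔ SimpleGraph.fromEdgeSet {s(u, v)}).Adj a' c' →
      (G ⊔ SimpleGraph.fromEdgeSet {s(u, v)}).Adj a' d' →
      (G ⊔ SimpleGraph.fromEdgeSet {s(u, v)}).Adj b' c' →
      (G ⊔ SimpleGraph.fromEdgeSet {s(u, v)}).Adj b' d' →
      (G ⊔ SimpleGraph.fromEdgeSet {s(u, v)}).Adj c' d' →
      ∀ x, (x = a ∨ x = b ∨ x = c ∨ x = d) → (x = a' ∨ x = b' ∨ x = c' ∨ x = d') := by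
    intro u v huv hn a b c d a' b' c' d' h0 h0' h1 h2 h3 h4 h5 h1' h2' h3' h4' h5' x hx
    obtain ⟨H, hH, hv⟩ := data_copy h0 h1 h2 h3 h4 h5
    obtain ⟨H', hH', hv'⟩ := data_copy h0' h1' h2' h3' h4' h5'
    have := (hsat u v huv hn).unique hH hH'
    subst this
    have hx' : x ∈ H.verts := by rw [hv]; simpa using hx
    rw [hv'] at hx'
    simpa using hx'
  have te1 : ∀ u v : V, u ≠ v → ¬ G.Adj u v → ∀ w w', G.Adj u w → G.Adj v w → TE G u w →
    G.Adj u w' → G.Adj v w' → w' = w := by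
    rintro u v huv hn w w' h1 h2 ⟨-, z, h3, h4⟩ h5 h6
    by_contra hne
    have hzv : z ≠ v := by rintro rfl; exact hn h3
    have hzw' : z ≠ w' := by
      rintro rfl
      exact df u v w z huv h1 h3 h2 h6 h4
    have A := adj u v huv
    have := uq u v huv hn z v u w w w' u v hzv (Ne.symm hne)
      ((A _ _).2 (.inl h3.symm)) ((A _ _).2 (.inl h4.symm)) ((A _ _).2 (by simp))
      ((A _ _).2 (.inl h2)) ((A _ _).2 (.inl h1))
      ((A _ _).2 (.inl h1.symm)) ((A _ _).2 (.inl h2.symm)) ((A _ _).2 (.inl h5.symm))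
      ((A _ _).2 (.inl h6.symm)) ((A _ _).2 (by simp)) z (by simp)
    rcases this with h | h | h | h
    · exact h4.ne h.symm
    · exact hzw' h
    · exact h3.ne h.symm
    · exact hzv h
  refine ⟨df, ?_, ?_, te1, ?_⟩
  · intro u v huv hn
    obtain ⟨H, hH, -⟩ := hsat u v huv hn
    obtain ⟨a, b, c, d, hab, hac, had, hbc, hbd, hcd⟩ := copy_data H hH
    have e1 := hac.ne
    have e2 := had.ne
    have e3 := hbc.ne
    have e4 := hbd.ne
    have e5 := hcd.ne
    rw [adj u v huv] at hac had hbc hbd hcd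
    have := df a b c d hab
    have sy := G.adj_comm
    unfold TE
    rcases hcd with hcd | ⟨rfl, rfl⟩ | ⟨rfl, rfl⟩
    · rcases hac with hac | ⟨rfl, rfl⟩ | ⟨rfl, rfl⟩
      · rcases had with had | ⟨rfl, rfl⟩ | ⟨rfl, rfl⟩
        · rcases hbc with hbc | ⟨rfl, rfl⟩ | ⟨rfl, rfl⟩
          · rcases hbd with hbd | ⟨rfl, rfl⟩ | ⟨rfl, rfl⟩
            · grind
            · right; refine ⟨c, ?_⟩; grind
            · right; refine ⟨c, ?_⟩; grind
          · right; refine ⟨d, ?_⟩; grind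
          · right; refine ⟨d, ?_⟩; grind
        · right; refine ⟨c, ?_⟩; grind
        · right; refine ⟨c, ?_⟩; grind
      · right; refine ⟨d, ?_⟩; grind
      · right; refine ⟨d, ?_⟩; grind
    · left; refine ⟨a, b, ?_⟩; grind
    · left; refine ⟨a, b, ?_⟩; grind
  · intro u v huv hn a b c h1 h2 h3 h4 h5 h6 hab
    by_contra hc
    push Not at hc
    have A := adj u v huv
    have := uq u v huv hn c b u v a b u v hc.2 hab
      ((A _ _).2 (.inl h5.symm)) ((A _ _).2 (.inl h6.symm)) ((A _ _).2 (.inl h3.symm))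
      ((A _ _).2 (.inl h4.symm)) ((A _ _).2 (by simp))
      ((A _ _).2 (.inl h1.symm)) ((A _ _).2 (.inl h2.symm)) ((A _ _).2 (.inl h3.symm))
      ((A _ _).2 (.inl h4.symm)) ((A _ _).2 (by simp)) c (by simp)
    rcases this with h | h | h | h
    · exact hc.1 h
    · exact hc.2 h
    · exact h5.ne h.symm
    · exact h6.ne h.symm
  · rintro u v huv hn w h1 h2 ⟨-, z, h3, h4⟩ ⟨-, z', h5, h6⟩
    have hzv : z ≠ v := by rintro rfl; exact hn h3
    have hzu : z' ≠ u := by rintro rfl; exact hn h5.symm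
    have A := adj u v huv
    have := uq u v huv hn z v u w z' u v w hzv hzu
      ((A _ _).2 (.inl h3.symm)) ((A _ _).2 (.inl h4.symm)) ((A _ _).2 (by simp))
      ((A _ _).2 (.inl h2)) ((A _ _).2 (.inl h1))
      ((A _ _).2 (.inl h5.symm)) ((A _ _).2 (.inl h6.symm)) ((A _ _).2 (by simp))
      ((A _ _).2 (.inl h1)) ((A _ _).2 (.inl h2)) z (by simp)
    rcases this with h | h | h | h
    · subst h
      exact df u v w z huv h1 h3 h2 h5 h4
    · exact h3.ne h.symm
    · exact hzv h
    · exact h4.ne h.symm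

/-- If no common neighbour is joined by a triangle edge, there are exactly two of them. -/
lemma Good.two {V : Type*} {G : SimpleGraph V} (hG : Good G) {u v : V} (huv : u ≠ v)
    (hn : ¬ G.Adj u v) (hte : ∀ w, G.Adj u w → G.Adj v w → ¬ TE G u w ∧ ¬ TE G v w) :
    ∃ a b, a ≠ b ∧ ∀ w, (G.Adj u w ∧ G.Adj v w) ↔ (w = a ∨ w = b) := by
  rcases hG.ex u v huv hn with ⟨a, b, hab, h1, h2, h3, h4⟩ | ⟨w, h1, h2, h3⟩
  · refine ⟨a, b, hab, fun w => ⟨fun h => hG.three u v huv hn a b w h1 h2 h3 h4 h.1 h.2 hab, ?_⟩⟩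
    rintro (rfl | rfl)
    · exact ⟨h1, h2⟩
    · exact ⟨h3, h4⟩
  · have := hte w h1 h2
    tauto

/-- `G` has exactly the two disjoint triangles `s`, `t` (as clique sets). -/
structure Two {V : Type*} (G : SimpleGraph V) (s t : Set V) : Prop where
  good : Good G
  disj : ∀ x, x ∈ s → x ∉ t
  cs : ∀ x y, x ∈ s → y ∈ s → x ≠ y → G.Adj x y
  ct : ∀ x y, x ∈ t → y ∈ t → x ≠ y → G.Adj x y
  tri : ∀ x y z, G.Adj x y → G.Adj x z → G.Adj y z →
    (x ∈ s ∧ y ∈ s ∧ z ∈ s) ∨ (x ∈ t ∧ y ∈ t ∧ z ∈ t)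
  s3 : ∃ a b c, a ≠ b ∧ a ≠ c ∧ b ≠ c ∧ a ∈ s ∧ b ∈ s ∧ c ∈ s
  t3 : ∃ a b c, a ≠ b ∧ a ≠ c ∧ b ≠ c ∧ a ∈ t ∧ b ∈ t ∧ c ∈ t

namespace Two
variable {V : Type*} {G : SimpleGraph V} {s t : Set V}

lemma te_s (h : Two G s t) {x y : V} (hx : x ∈ s) (hy : y ∈ s) (hxy : x ≠ y) : TE G x y := by
  obtain ⟨a, b, c, hab, hac, hbc, ha, hb, hc⟩ := h.s3
  have : ∃ z, z ∈ s ∧ z ≠ x ∧ z ≠ y := by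
    by_contra hcon
    push Not at hcon
    have k1 := hcon a ha
    have k2 := hcon b hb
    have k3 := hcon c hc
    by_cases a = x <;> by_cases b = x <;> by_cases c = x <;> simp_all
  obtain ⟨z, hz, h1, h2⟩ := this
  exact ⟨h.cs x y hx hy hxy, z, h.cs x z hx hz h1.symm, h.cs y z hy hz h2.symm⟩

lemma te_mem (h : Two G s t) {x y : V} (hxy : TE G x y) :
    (x ∈ s ∧ y ∈ s) ∨ (x ∈ t ∧ y ∈ t) := by
  obtain ⟨h1, z, h2, h3⟩ := hxy
  have := h.tri x y z h1 h2 h3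
  tauto

lemma swap (h : Two G s t) : Two G t s where
  good := h.good
  disj := fun x hx hx' => h.disj x hx' hx
  cs := h.ct
  ct := h.cs
  tri := fun x y z h1 h2 h3 => (h.tri x y z h1 h2 h3).symm
  s3 := h.t3
  t3 := h.s3

/-- At most one vertex of `s` has a neighbour in `t`. -/
lemma atmost (h : Two G s t) {p q b b' : V} (hp : p ∈ s) (hq : q ∈ s) (hpq : p ≠ q)
    (hb : b ∈ t) (hb' : b' ∈ t) (h1 : G.Adj p b) (h2 : G.Adj q b') : False := by
  have hbs : b ∉ s := fun hh => h.disj b hh hb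
  have hb's : b' ∉ s := fun hh => h.disj b' hh hb'
  have hpt := h.disj p hp
  by_cases hbb : b = b'
  · subst hbb
    have := h.tri p q b (h.cs p q hp hq hpq) h1 h2
    tauto
  · have hn : ¬ G.Adj p b' := by
      intro hh
      have := h.tri p b b' h1 hh (h.ct b b' hb hb' hbb)
      tauto
    have hpb' : p ≠ b' := by rintro rfl; exact hpt hb'
    have := h.good.te1 p b' hpb' hn q b (h.cs p q hp hq hpq) h2.symm (h.te_s hp hq hpq) h1
      (h.ct b' b hb' hb (Ne.symm hbb))
    subst this
    exact hbs hq

lemma out (h : Two G s t) {x p q : V} (hx : x ∉ s) (hp : p ∈ s) (hq : q ∈ s) (hpq : p ≠ q)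
    (h1 : G.Adj p x) : ¬ G.Adj q x := by
  intro h2
  have := h.tri p q x (h.cs p q hp hq hpq) h1 h2
  have := h.disj p hp
  tauto

/-- The neighbours of `x ∈ P` other than `p` lie in `R`. -/
lemma nbr (h : Two G s t) {x p y : V} (hx : x ∉ s) (hp : p ∈ s) (hpx : G.Adj p x)
    (hxy : G.Adj x y) (hyp : y ≠ p) : y ∉ s ∧ ∀ q ∈ s, ¬ G.Adj q y := by
  have hys : y ∉ s := fun hy => h.out hx hp hy hyp.symm hpx hxy.symm
  refine ⟨hys, fun q hq hqy => ?_⟩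
  by_cases hqp : q = p
  · subst hqp
    have := h.tri q x y hpx hqy hxy
    have := h.disj q hq
    tauto
  · have hn := h.out hx hp hq (Ne.symm hqp) hpx
    have hqx : q ≠ x := by rintro rfl; exact hx hq
    exact hyp (h.good.te1 q x hqx hn p y (h.cs q p hq hp hqp) hpx.symm (h.te_s hq hp hqp) hqy hxy)

/-- A vertex of `R` has exactly two neighbours adjacent to `p`. -/
lemma rp (h : Two G s t) {v p : V} (hv : v ∉ s) (hvs : ∀ q ∈ s, ¬ G.Adj q v) (hp : p ∈ s)
    (hpt : ∀ b ∈ t, ¬ G.Adj p b) :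
    ∃ a b, a ≠ b ∧ ∀ w, (G.Adj p w ∧ G.Adj v w) ↔ (w = a ∨ w = b) := by
  have hpv : p ≠ v := by rintro rfl; exact hv hp
  refine h.good.two hpv (hvs p hp) fun w h1 h2 => ⟨fun hh => ?_, fun hh => ?_⟩
  · rcases h.te_mem hh with ⟨_, h4⟩ | ⟨h4, _⟩
    · exact hvs w h4 h2.symm
    · exact h.disj p hp h4
  · rcases h.te_mem hh with ⟨h4, _⟩ | ⟨_, h4⟩
    · exact hv h4
    · exact hpt w h4 h1

lemma half [Fintype V] (h : Two G s t) {p q : V} (hp : p ∈ s) (hq : q ∈ s) (hpq : p ≠ q)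
    (hpt : ∀ b ∈ t, ¬ G.Adj p b) (hqt : ∀ b ∈ t, ¬ G.Adj q b) (P Q : Finset V)
    (hP : ∀ x, x ∈ P ↔ (G.Adj p x ∧ x ∉ s)) (hQ : ∀ x, x ∈ Q ↔ (G.Adj q x ∧ x ∉ s))
    (hne : P.Nonempty) : P.card = Q.card + 1 := by
  classical
  obtain ⟨x, hxP⟩ := hne
  obtain ⟨hpx, hxs⟩ := (hP x).1 hxP
  have hxt : x ∉ t := fun hh => hpt x hh hpx
  have hxte : ∀ w, ¬ TE G x w := fun w hh => by
    have := h.te_mem hh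
    tauto
  let D : Finset V := Finset.univ.filter fun v => G.Adj x v ∧ v ≠ p
  have hD : ∀ v, v ∈ D ↔ (G.Adj x v ∧ v ≠ p) := by simp [D]
  have hDR : ∀ v ∈ D, v ∉ s ∧ ∀ q ∈ s, ¬ G.Adj q v := fun v hv =>
    h.nbr hxs hp hpx ((hD v).1 hv).1 ((hD v).1 hv).2
  have c1 : (P.erase x).card * 1 = D.card * 1 := by
    refine Finset.card_mul_eq_card_mul G.Adj ?_ ?_
    · intro y hy
      obtain ⟨hyx, hyP⟩ := Finset.mem_erase.1 hy
      obtain ⟨hpy, hys⟩ := (hP y).1 hyP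
      have hyt : y ∉ t := fun hh => hpt y hh hpy
      have hn : ¬ G.Adj x y := fun hh => (h.nbr hxs hp hpx hh hpy.ne').2 p hp hpy
      obtain ⟨a, b, hab, hw⟩ := h.good.two hyx.symm hn fun w _ _ => ⟨hxte w, fun hh => by
        have := h.te_mem hh
        tauto⟩
      have hpab := (hw p).1 ⟨hpx.symm, hpy.symm⟩
      have : ∃ c, ∀ w, w ∈ D.bipartiteAbove G.Adj y ↔ w = c := by
        rcases hpab with rfl | rfl
        · refine ⟨b, fun w => ?_⟩
          rw [Finset.mem_bipartiteAbove, hD]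
          have := hw w
          grind
        · refine ⟨a, fun w => ?_⟩
          rw [Finset.mem_bipartiteAbove, hD]
          have := hw w
          grind
      obtain ⟨c, hc⟩ := this
      rw [Finset.card_eq_one]
      exact ⟨c, by ext w; simp [hc w]⟩
    · intro v hv
      obtain ⟨hvs, hvR⟩ := hDR v hv
      obtain ⟨a, b, hab, hw⟩ := h.rp hvs hvR hp hpt
      have hxv := ((hD v).1 hv).1
      have hxab := (hw x).1 ⟨hpx, hxv.symm⟩
      have hm : ∀ w, w ∈ (P.erase x).bipartiteBelow G.Adj v ↔
          w ≠ x ∧ (G.Adj p w ∧ G.Adj v w) := by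
        intro w
        rw [Finset.mem_bipartiteBelow, Finset.mem_erase, hP, G.adj_comm w v]
        constructor
        · tauto
        · rintro ⟨h1, h2, h3⟩
          exact ⟨⟨h1, h2, fun hh => hvR w hh h3.symm⟩, h3⟩
      rw [Finset.card_eq_one]
      rcases hxab with rfl | rfl
      · exact ⟨b, by ext w; rw [hm, hw, Finset.mem_singleton]; grind⟩
      · exact ⟨a, by ext w; rw [hm, hw, Finset.mem_singleton]; grind⟩
  have c2 : Q.card * 2 = D.card * 2 := by
    refine Finset.card_mul_eq_card_mul G.Adj ?_ ?_
    · intro y hy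
      obtain ⟨hqy, hys⟩ := (hQ y).1 hy
      have hyt : y ∉ t := fun hh => hqt y hh hqy
      have hpy : ¬ G.Adj p y := h.out hys hq hp hpq.symm hqy
      have hxy : x ≠ y := by rintro rfl; exact hpy hpx
      have hyp : y ≠ p := by rintro rfl; exact hys hp
      have hn : ¬ G.Adj x y := fun hh => (h.nbr hxs hp hpx hh hyp).2 q hq hqy
      obtain ⟨a, b, hab, hw⟩ := h.good.two hxy hn fun w _ _ => ⟨hxte w, fun hh => by
        have := h.te_mem hh
        tauto⟩
      rw [Finset.card_eq_two]
      refine ⟨a, b, hab, ?_⟩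
      ext w
      rw [Finset.mem_bipartiteAbove, hD, Finset.mem_insert, Finset.mem_singleton, ← hw]
      constructor
      · tauto
      · rintro ⟨h1, h2⟩
        refine ⟨⟨h1, ?_⟩, h2⟩
        rintro rfl
        exact hpy h2.symm
    · intro v hv
      obtain ⟨hvs, hvR⟩ := hDR v hv
      obtain ⟨a, b, hab, hw⟩ := h.rp hvs hvR hq hqt
      rw [Finset.card_eq_two]
      refine ⟨a, b, hab, ?_⟩
      ext w
      rw [Finset.mem_bipartiteBelow, hQ, Finset.mem_insert, Finset.mem_singleton, ← hw,
        G.adj_comm w v]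
      constructor
      · tauto
      · rintro ⟨h1, h2⟩
        exact ⟨⟨h1, fun hh => hvR w hh h2.symm⟩, h2⟩
  have := Finset.card_erase_add_one hxP
  omega

/-- There are two vertices of `s` without neighbours in `t`. -/
lemma pick (h : Two G s t) : ∃ p q, p ≠ q ∧ p ∈ s ∧ q ∈ s ∧ (∀ b ∈ t, ¬ G.Adj p b) ∧
    (∀ b ∈ t, ¬ G.Adj q b) := by
  obtain ⟨a, b, c, hab, hac, hbc, ha, hb, hc⟩ := h.s3
  have key : ∀ x y, x ∈ s → y ∈ s → x ≠ y →
      (∀ b ∈ t, ¬ G.Adj x b) ∨ (∀ b ∈ t, ¬ G.Adj y b) := by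
    intro x y hx hy hxy
    by_contra hcon
    push Not at hcon
    obtain ⟨⟨b, hb, h1⟩, b', hb', h2⟩ := hcon
    exact h.atmost hx hy hxy hb hb' h1 h2
  have k1 := key a b ha hb hab
  have k2 := key a c ha hc hac
  have k3 := key b c hb hc hbc
  by_cases hA : ∀ b ∈ t, ¬ G.Adj a b
  · rcases k3 with k | k
    · exact ⟨a, b, hab, ha, hb, hA, k⟩
    · exact ⟨a, c, hac, ha, hc, hA, k⟩
  · exact ⟨b, c, hbc, hb, hc, k1.resolve_left hA, k2.resolve_left hA⟩

lemma contra [Fintype V] (h : Two G s t) : False := by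
  classical
  obtain ⟨p, q, hpq, hp, hq, hpt, hqt⟩ := h.pick
  obtain ⟨v, -, -, hv, -, hvs, -⟩ := h.swap.pick
  have hvs' : v ∉ s := fun hh => h.disj v hh hv
  have hR : ∀ q ∈ s, ¬ G.Adj q v := fun q hq hh => hvs q hq hh.symm
  let N : V → Finset V := fun p => Finset.univ.filter fun x => G.Adj p x ∧ x ∉ s
  have hN : ∀ p x, x ∈ N p ↔ (G.Adj p x ∧ x ∉ s) := by simp [N]
  have ne : ∀ p ∈ s, (∀ b ∈ t, ¬ G.Adj p b) → (N p).Nonempty := by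
    intro p hp hpt
    obtain ⟨a, b, -, hw⟩ := h.rp hvs' hR hp hpt
    obtain ⟨h1, h2⟩ := (hw a).2 (.inl rfl)
    exact ⟨a, (hN p a).2 ⟨h1, fun hh => hR a hh h2.symm⟩⟩
  have e1 := h.half hp hq hpq hpt hqt (N p) (N q) (hN p) (hN q) (ne p hp hpt)
  have e2 := h.half hq hp hpq.symm hqt hpt (N q) (N p) (hN q) (hN p) (ne q hq hqt)
  omega

end Two

theorem stmt13 {V : Type*} [Fintype V] (G : SimpleGraph V)
    (hcount : (G.cliqueSet 3).ncard = 2) :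
    ¬ UniquelySaturated diamond G := by
  classical
  intro hus
  have hG := good_of hus
  obtain ⟨s, t, hst, heq⟩ := Set.ncard_eq_two.1 hcount
  have hs : G.IsNClique 3 s := by
    rw [← mem_cliqueSet_iff, heq]; simp
  have ht : G.IsNClique 3 t := by
    rw [← mem_cliqueSet_iff, heq]; simp
  have tri : ∀ x y z, G.Adj x y → G.Adj x z → G.Adj y z →
      (x ∈ s ∧ y ∈ s ∧ z ∈ s) ∨ (x ∈ t ∧ y ∈ t ∧ z ∈ t) := by
    intro x y z h1 h2 h3
    have : ({x, y, z} : Finset V) ∈ G.cliqueSet 3 := by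
      rw [mem_cliqueSet_iff, is3Clique_triple_iff]
      exact ⟨h1, h2, h3⟩
    rw [heq] at this
    rcases this with h | h
    · left; rw [← h]; simp
    · right; rw [← Set.mem_singleton_iff.1 h]; simp
  have cs : ∀ x y, x ∈ s → y ∈ s → x ≠ y → G.Adj x y := fun x y hx hy hxy => hs.1 hx hy hxy
  have ct : ∀ x y, x ∈ t → y ∈ t → x ≠ y → G.Adj x y := fun x y hx hy hxy => ht.1 hx hy hxy
  have three : ∀ u : Finset V, u.card = 3 →
      ∃ a b c, a ≠ b ∧ a ≠ c ∧ b ≠ c ∧ a ∈ u ∧ b ∈ u ∧ c ∈ u := by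
    intro u hu
    obtain ⟨a, b, c, h1, h2, h3, rfl⟩ := Finset.card_eq_three.1 hu
    exact ⟨a, b, c, h1, h2, h3, by simp⟩
  have te : ∀ u : Finset V, G.IsNClique 3 u → ∀ x y, x ∈ u → y ∈ u → x ≠ y → TE G x y := by
    intro u hu x y hx hy hxy
    have : ∃ z, z ∈ u ∧ z ≠ x ∧ z ≠ y := by
      by_contra hcon
      push Not at hcon
      obtain ⟨a, b, c, h1, h2, h3, ha, hb, hc⟩ := three u hu.2
      have k1 := hcon a ha
      have k2 := hcon b hb
      have k3 := hcon c hc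
      by_cases a = x <;> by_cases b = x <;> by_cases c = x <;> simp_all
    obtain ⟨z, hz, h1, h2⟩ := this
    exact ⟨hu.1 hx hy hxy, z, hu.1 hx hz h1.symm, hu.1 hy hz h2.symm⟩
  have disj : ∀ x, x ∈ s → x ∉ t := by
    intro c hcs hct
    have hns : ¬ s ⊆ t := fun hh =>
      hst (Finset.eq_of_subset_of_card_le hh (by rw [hs.2, ht.2]))
    have hnt : ¬ t ⊆ s := fun hh =>
      hst (Finset.eq_of_subset_of_card_le hh (by rw [hs.2, ht.2])).symm
    obtain ⟨a, has, hat⟩ := Finset.not_subset.1 hns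
    obtain ⟨d, hdt, hds⟩ := Finset.not_subset.1 hnt
    have hac : a ≠ c := by rintro rfl; exact hat hct
    have hdc : d ≠ c := by rintro rfl; exact hds hcs
    have had : a ≠ d := by rintro rfl; exact hat hdt
    have hn : ¬ G.Adj a d := by
      intro hh
      have := tri a d c hh (cs a c has hcs hac) (ct d c hdt hct hdc)
      tauto
    exact hG.te2 a d had hn c (cs a c has hcs hac) (ct d c hdt hct hdc)
      (te s hs a c has hcs hac) (te t ht d c hdt hct hdc)
  have h2 : Two G (s : Set V) (t : Set V) :=
    { good := hG
      disj := by simpa using disj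
      cs := by simpa using cs
      ct := by simpa using ct
      tri := by simpa using tri
      s3 := by simpa using three s hs.2
      t3 := by simpa using three t ht.2 }
  exact h2.contra
end
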